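/- arXiv:2401.02356 — 3 statements merged into one kernel-verified Lean document; each statement's English description precedes it below -/
import Mathlib

section
/- Let d ∈ {2, 3} and let Ω ⊆ ℝ^d be a bounded open set. There exists a constant C depending only on Ω and d such that for all test fields u and w (continuously differentiable, divergence-free, with compact support contained in Ω), writing v := w − u, the difference of the convective terms satisfies |∫_Ω ⟨(w·∇)w − (u·∇)u, v⟩ dx| ≤ C · ((∫_Ω |∇w|² dx)^{1/2} + (∫_Ω |∇u|² dx)^{1/2}) · ∫_Ω |∇v|² dx. (This is estimate (nonlin) in the proof of Theorem 2.) -/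
open MeasureTheory
open scoped RealInnerProductSpace

noncomputable section

/-- A test field on `Ω`: continuously differentiable, divergence-free, with
compact support contained in `Ω`. -/
def IsTestField {d : ℕ} (Ω : Set (EuclideanSpace ℝ (Fin d)))
    (w : EuclideanSpace ℝ (Fin d) → EuclideanSpace ℝ (Fin d)) : Prop :=
  ContDiff ℝ 1 w ∧
    (∀ x, ∑ i : Fin d, fderiv ℝ w x (EuclideanSpace.single i 1) i = 0) ∧
    HasCompactSupport w ∧ tsupport w ⊆ Ω

/-- `⟨∇u, ∇v⟩(x) = ∑_{i,j} ∂_j u_i(x) ∂_j v_i(x)`. -/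
def gradInner {d : ℕ} (u v : EuclideanSpace ℝ (Fin d) → EuclideanSpace ℝ (Fin d))
    (x : EuclideanSpace ℝ (Fin d)) : ℝ :=
  ∑ j : Fin d, ⟪fderiv ℝ u x (EuclideanSpace.single j 1),
    fderiv ℝ v x (EuclideanSpace.single j 1)⟫

open scoped ENNReal NNReal

theorem enorm_integral_le_of_norm_le_mul_mul_add {α : Type*} {m : MeasurableSpace α}
    {μ : Measure α} {E₁ E₂ E₃ G : Type*} [NormedAddCommGroup E₁] [NormedAddCommGroup E₂]
    [NormedAddCommGroup E₃] [NormedAddCommGroup G] [NormedSpace ℝ G]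
    {a₁ a₂ : α → E₁} {b₁ b₂ : α → E₂} {c : α → E₃} {F : α → G}
    (ha₁ : AEStronglyMeasurable a₁ μ) (ha₂ : AEStronglyMeasurable a₂ μ)
    (hb₁ : AEStronglyMeasurable b₁ μ) (hb₂ : AEStronglyMeasurable b₂ μ)
    (hc : AEStronglyMeasurable c μ)
    (hF : ∀ x, ‖F x‖ ≤ ‖a₁ x‖ * ‖b₁ x‖ * ‖c x‖ + ‖a₂ x‖ * ‖b₂ x‖ * ‖c x‖) :
    ‖∫ x, F x ∂μ‖ₑ ≤ eLpNorm a₁ 4 μ * eLpNorm b₁ 2 μ * eLpNorm c 4 μ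
      + eLpNorm a₂ 4 μ * eLpNorm b₂ 2 μ * eLpNorm c 4 μ := by
  have : ENNReal.HolderTriple 4 4 2 := ⟨by
    rw [← ENNReal.toReal_eq_toReal_iff' (by simp) (by simp),
      ENNReal.toReal_add (by simp) (by simp)]
    norm_num⟩
  have triple {a : α → E₁} {b : α → E₂} (ha : AEStronglyMeasurable a μ)
      (hb : AEStronglyMeasurable b μ) :
      ∫⁻ x, ‖a x‖ₑ * ‖b x‖ₑ * ‖c x‖ₑ ∂μ ≤ eLpNorm a 4 μ * eLpNorm b 2 μ * eLpNorm c 4 μ := by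
    have hac := eLpNorm_smul_le_mul_eLpNorm (r := 2) (p := 4) (q := 4) hc.norm ha.norm
    have habc := eLpNorm_smul_le_mul_eLpNorm (r := 1) (p := 2) (q := 2)
      (ha.norm.smul hc.norm) hb.norm
    calc _ = eLpNorm ((fun x ↦ ‖b x‖) • (fun x ↦ ‖a x‖) • fun x ↦ ‖c x‖) 1 μ := by
          rw [eLpNorm_one_eq_lintegral_enorm]
          congr with x
          simp only [Pi.smul_apply', Pi.mul_apply, smul_eq_mul, enorm_mul, enorm_norm]
          ring
      _ ≤ eLpNorm b 2 μ * (eLpNorm a 4 μ * eLpNorm c 4 μ) := by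
          simp only [eLpNorm_norm] at hac habc
          exact habc.trans (by gcongr)
      _ = _ := by ring
  calc ‖∫ x, F x ∂μ‖ₑ ≤ ∫⁻ x, ‖F x‖ₑ ∂μ := enorm_integral_le_lintegral_enorm F
    _ ≤ ∫⁻ x, (‖a₁ x‖ₑ * ‖b₁ x‖ₑ * ‖c x‖ₑ + ‖a₂ x‖ₑ * ‖b₂ x‖ₑ * ‖c x‖ₑ) ∂μ := by
        refine lintegral_mono fun x ↦ ?_
        simpa [enorm, ← NNReal.coe_le_coe, ← ENNReal.coe_mul, ← ENNReal.coe_add] using hF x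
    _ = ∫⁻ x, ‖a₁ x‖ₑ * ‖b₁ x‖ₑ * ‖c x‖ₑ ∂μ + ∫⁻ x, ‖a₂ x‖ₑ * ‖b₂ x‖ₑ * ‖c x‖ₑ ∂μ :=
        lintegral_add_left' ((ha₁.enorm.mul hb₁.enorm).mul hc.enorm) _
    _ ≤ _ := add_le_add (triple ha₁ hb₁) (triple ha₂ hb₂)

/-- Sobolev embedding `H¹₀(Ω) ⊆ L⁴(Ω)` for bounded `Ω` in dimensions two and three. -/
theorem exists_eLpNorm_four_le_eLpNorm_fderiv {d : ℕ} (hd : d = 2 ∨ d = 3)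
    {F : Type*} [NormedAddCommGroup F] [NormedSpace ℝ F] [FiniteDimensional ℝ F]
    {Ω : Set (EuclideanSpace ℝ (Fin d))} (hΩ : Bornology.IsBounded Ω) :
    ∃ C : ℝ≥0, ∀ f : EuclideanSpace ℝ (Fin d) → F, ContDiff ℝ 1 f → tsupport f ⊆ Ω →
      eLpNorm f 4 (volume.restrict Ω) ≤ C * eLpNorm (fderiv ℝ f) 2 (volume.restrict Ω) := by
  have hvol : volume Ω ≠ ∞ := hΩ.measure_lt_top.ne
  refine ⟨eLpNormLESNormFDerivOfLeConst F volume Ω (12 / 7) 4 *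
    (volume Ω ^ ((7 : ℝ) / 12 - 1 / 2)).toNNReal, fun f hf hfΩ ↦ ?_⟩
  have hsupp : Function.support f ⊆ Ω := (subset_tsupport f).trans hfΩ
  have hsupp' : Function.support (fderiv ℝ f) ⊆ Ω := (support_fderiv_subset ℝ).trans hfΩ
  have hsob := eLpNorm_le_eLpNorm_fderiv_of_le volume (p := 12 / 7) (q := 4) hf hsupp
    (by rw [← NNReal.coe_le_coe]; norm_num)
    (by
      rw [← NNReal.coe_lt_coe]
      rcases hd with rfl | rfl <;> norm_num)
    (by rcases hd with rfl | rfl <;> norm_num) hΩ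
  have hemb := eLpNorm_le_eLpNorm_mul_rpow_measure_univ (μ := volume.restrict Ω)
    (p := ((12 / 7 : ℝ≥0) : ℝ≥0∞)) (q := 2) (f := fderiv ℝ f)
    (by
      rw [show (2 : ℝ≥0∞) = ((2 : ℝ≥0) : ℝ≥0∞) by simp, ENNReal.coe_le_coe, ← NNReal.coe_le_coe]
      norm_num)
    (hf.continuous_fderiv one_ne_zero).aestronglyMeasurable
  rw [← eLpNorm_restrict_eq_of_support_subset hsupp,
    ← eLpNorm_restrict_eq_of_support_subset (f := fderiv ℝ f) hsupp'] at hsob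
  have hexp : (1 / ((12 / 7 : ℝ≥0) : ℝ≥0∞).toReal - 1 / (2 : ℝ≥0∞).toReal : ℝ)
      = 7 / 12 - 1 / 2 := by
    simp
  rw [hexp, Measure.restrict_apply_univ] at hemb
  calc eLpNorm f 4 (volume.restrict Ω)
      ≤ eLpNormLESNormFDerivOfLeConst F volume Ω (12 / 7) 4 *
          (eLpNorm (fderiv ℝ f) 2 (volume.restrict Ω) * volume Ω ^ ((7 : ℝ) / 12 - 1 / 2)) := by
        rw [ENNReal.coe_ofNat] at hsob
        refine hsob.trans ?_
        gcongr
    _ = _ := by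
        rw [ENNReal.coe_mul, ENNReal.coe_toNNReal (ENNReal.rpow_ne_top_of_nonneg (by norm_num) hvol)]
        ring

theorem opNorm_sq_le_sum_norm_apply_single_sq {d : ℕ} {F : Type*} [NormedAddCommGroup F]
    [NormedSpace ℝ F] (L : EuclideanSpace ℝ (Fin d) →L[ℝ] F) :
    ‖L‖ ^ 2 ≤ ∑ j, ‖L (EuclideanSpace.single j 1)‖ ^ 2 := by
  rw [← Real.le_sqrt (norm_nonneg _) (by positivity)]
  refine L.opNorm_le_bound (Real.sqrt_nonneg _) fun x ↦ ?_
  calc ‖L x‖ = ‖∑ j, x j • L (EuclideanSpace.single j 1)‖ := by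
        conv_lhs => rw [← (EuclideanSpace.basisFun (Fin d) ℝ).sum_repr x]
        simp
    _ ≤ ∑ j, ‖L (EuclideanSpace.single j 1)‖ * ‖x j‖ := by
        refine (norm_sum_le _ _).trans_eq ?_
        simp [norm_smul, mul_comm]
    _ ≤ _ := by
        rw [EuclideanSpace.norm_eq]
        exact Real.sum_mul_le_sqrt_mul_sqrt _ _ _

theorem gradInner_self {d : ℕ} (f : EuclideanSpace ℝ (Fin d) → EuclideanSpace ℝ (Fin d))
    (x : EuclideanSpace ℝ (Fin d)) :
    gradInner f f x = ∑ j, ‖fderiv ℝ f x (EuclideanSpace.single j 1)‖ ^ 2 := by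
  simp [gradInner]

theorem eLpNorm_fderiv_two_le_sqrt_integral_gradInner {d : ℕ}
    {f : EuclideanSpace ℝ (Fin d) → EuclideanSpace ℝ (Fin d)} (hf : ContDiff ℝ 1 f)
    (hfs : HasCompactSupport f) (Ω : Set (EuclideanSpace ℝ (Fin d))) :
    eLpNorm (fderiv ℝ f) 2 (volume.restrict Ω)
      ≤ ENNReal.ofReal (Real.sqrt (∫ x in Ω, gradInner f f x)) := by
  have hcont : Continuous (fderiv ℝ f) := hf.continuous_fderiv one_ne_zero
  have hcomp : HasCompactSupport (fderiv ℝ f) := hfs.fderiv ℝ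
  rw [(hcont.memLp_of_hasCompactSupport hcomp).eLpNorm_eq_integral_rpow_norm
    two_ne_zero ENNReal.ofNat_ne_top, Real.sqrt_eq_rpow]
  simp only [ENNReal.toReal_ofNat, Real.rpow_ofNat, one_div]
  gcongr ENNReal.ofReal (?_ ^ _)
  refine integral_mono_of_nonneg (.of_forall fun x ↦ by positivity) ?_
    (.of_forall fun x ↦ (opNorm_sq_le_sum_norm_apply_single_sq _).trans_eq
      (gradInner_self f x).symm)
  have : HasCompactSupport (gradInner f f) := hcomp.mono' fun x hx ↦ subset_tsupport _ fun h ↦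
    hx (by simp [gradInner, h])
  refine (Continuous.integrable_of_hasCompactSupport ?_ this).integrableOn
  unfold gradInner
  fun_prop

theorem norm_inner_convective_sub_le {d : ℕ}
    {u w : EuclideanSpace ℝ (Fin d) → EuclideanSpace ℝ (Fin d)} {x : EuclideanSpace ℝ (Fin d)}
    (hu : DifferentiableAt ℝ u x) (hw : DifferentiableAt ℝ w x) :
    ‖⟪fderiv ℝ w x (w x) - fderiv ℝ u x (u x), w x - u x⟫‖
      ≤ ‖w x‖ * ‖fderiv ℝ (w - u) x‖ * ‖(w - u) x‖
        + ‖(w - u) x‖ * ‖fderiv ℝ u x‖ * ‖(w - u) x‖ := by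
  have hsplit : fderiv ℝ w x (w x) - fderiv ℝ u x (u x)
      = fderiv ℝ (w - u) x (w x) + fderiv ℝ u x ((w - u) x) := by
    rw [fderiv_sub hw hu]
    simp
  rw [hsplit, inner_add_left]
  refine (norm_add_le _ _).trans (add_le_add ?_ ?_) <;>
  · refine (norm_inner_le_norm _ _).trans (mul_le_mul_of_nonneg_right ?_ (norm_nonneg _))
    rw [mul_comm]
    exact ContinuousLinearMap.le_opNorm _ _

/-- Estimate (nonlin): the difference of convective terms tested against
`v = w − u` is controlled by the `H¹`-seminorms. -/
theorem convective_difference_estimate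
    (d : ℕ) (hd : d = 2 ∨ d = 3)
    (Ω : Set (EuclideanSpace ℝ (Fin d)))
    (hΩopen : IsOpen Ω) (hΩbdd : Bornology.IsBounded Ω) :
    ∃ C : ℝ, ∀ u w : EuclideanSpace ℝ (Fin d) → EuclideanSpace ℝ (Fin d),
      IsTestField Ω u → IsTestField Ω w →
      |∫ x in Ω, ⟪fderiv ℝ w x (w x) - fderiv ℝ u x (u x), w x - u x⟫|
        ≤ C * (Real.sqrt (∫ x in Ω, gradInner w w x)
                + Real.sqrt (∫ x in Ω, gradInner u u x))
            * ∫ x in Ω, gradInner (w - u) (w - u) x := by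
  obtain ⟨K, hK⟩ := exists_eLpNorm_four_le_eLpNorm_fderiv
    (F := EuclideanSpace ℝ (Fin d)) hd hΩbdd
  refine ⟨K ^ 2, fun u w ⟨hu, _, hus, huΩ⟩ ⟨hw, _, hws, hwΩ⟩ ↦ ?_⟩
  have hv : ContDiff ℝ 1 (w - u) := hw.sub hu
  have hvs : HasCompactSupport (w - u) := hws.sub hus
  have hvΩ : tsupport (w - u) ⊆ Ω := (tsupport_sub w u).trans (Set.union_subset hwΩ huΩ)
  have hL4 {f : EuclideanSpace ℝ (Fin d) → EuclideanSpace ℝ (Fin d)} (hf : ContDiff ℝ 1 f)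
      (hfs : HasCompactSupport f) (hfΩ : tsupport f ⊆ Ω) := (hK f hf hfΩ).trans
    (mul_le_mul_right (eLpNorm_fderiv_two_le_sqrt_integral_gradInner hf hfs Ω) _)
  have hgrad_nonneg : 0 ≤ ∫ x in Ω, gradInner (w - u) (w - u) x :=
    integral_nonneg fun x ↦ by rw [gradInner_self]; positivity
  have hfd {f : EuclideanSpace ℝ (Fin d) → EuclideanSpace ℝ (Fin d)} (hf : ContDiff ℝ 1 f) :
      AEStronglyMeasurable (fderiv ℝ f) (volume.restrict Ω) :=
    (hf.continuous_fderiv one_ne_zero).aestronglyMeasurable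
  have key := enorm_integral_le_of_norm_le_mul_mul_add (μ := volume.restrict Ω)
    hw.continuous.aestronglyMeasurable hv.continuous.aestronglyMeasurable (hfd hv) (hfd hu)
    hv.continuous.aestronglyMeasurable fun x ↦ norm_inner_convective_sub_le
      (hu.differentiable one_ne_zero x) (hw.differentiable one_ne_zero x)
  set a := Real.sqrt (∫ x in Ω, gradInner w w x)
  set b := Real.sqrt (∫ x in Ω, gradInner u u x)
  rw [← Real.sq_sqrt hgrad_nonneg]
  set c := Real.sqrt (∫ x in Ω, gradInner (w - u) (w - u) x)
  have hc₀ : 0 ≤ c := Real.sqrt_nonneg _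
  have hb₀ : 0 ≤ b := Real.sqrt_nonneg _
  have ha₀ : 0 ≤ a := Real.sqrt_nonneg _
  have hbound : ENNReal.ofReal |∫ x in Ω, ⟪fderiv ℝ w x (w x) - fderiv ℝ u x (u x), w x - u x⟫|
      ≤ ENNReal.ofReal (K ^ 2 * (a + b) * c ^ 2) := by
    rw [← Real.enorm_eq_ofReal_abs]
    calc _ ≤ _ := key
      _ ≤ (K * ENNReal.ofReal a) * ENNReal.ofReal c * (K * ENNReal.ofReal c)
          + (K * ENNReal.ofReal c) * ENNReal.ofReal b * (K * ENNReal.ofReal c) := by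
        gcongr
        · exact hL4 hw hws hwΩ
        · exact eLpNorm_fderiv_two_le_sqrt_integral_gradInner hv hvs Ω
        · exact hL4 hv hvs hvΩ
        · exact hL4 hv hvs hvΩ
        · exact eLpNorm_fderiv_two_le_sqrt_integral_gradInner hu hus Ω
        · exact hL4 hv hvs hvΩ
      _ = _ := by
        rw [← ENNReal.ofReal_coe_nnreal (p := K)]
        repeat rw [← ENNReal.ofReal_mul (by positivity)]
        rw [← ENNReal.ofReal_add (by positivity) (by positivity)]
        congr 1
        ring
  exact (ENNReal.ofReal_le_ofReal_iff (by positivity)).1 hbound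
end
end

section
/- Let ν > 0, m ≥ 1 and 0 ≤ θ ≤ ν/2. Let v : ℝ^d → ℝ^d be continuously differentiable with compact support and suppose: (i) the error inequality ν ∫_{Ω_F} |∇v|² dx + νm ∫_{Ω_S} |∇v|² dx ≤ ∫_{Ω_S} f·v dx + ∫_Σ |g·v| d𝓗^{d−1} + θ ∫_Ω |∇v|² dx holds; (ii) the Poincaré inequality ∫_{Ω_S} |v|² dx ≤ C_P ∫_{Ω_S} |∇v|² dx holds for some C_P ≥ 0; (iii) the trace inequality ∫_Σ |v|² d𝓗^{d−1} ≤ C_T ∫_{Ω_S} |∇v|² dx holds for some C_T ≥ 0. Then there is a constant C depending only on C_P, C_T, ∫_{Ω_S} |f|² dx and ∫_Σ |g|² d𝓗^{d−1} (but not on ν or m) such that (∫_{Ω_F} |∇v|² dx)^{1/2} ≤ C · ν^{-1} · m^{-1/2}. (This is the improved error estimate (visc:4) of Theorem 2, with v playing the role of u_m − u and θ the absorbed convective contribution under the smallness assumption on f.) -/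
open MeasureTheory
open scoped RealInnerProductSpace

noncomputable section

/-- `|∇v|²(x) = ∑_{i,j} (∂_j v_i(x))²`. -/
def gradSq {d : ℕ} (v : EuclideanSpace ℝ (Fin d) → EuclideanSpace ℝ (Fin d))
    (x : EuclideanSpace ℝ (Fin d)) : ℝ :=
  ∑ j : Fin d, ‖fderiv ℝ v x (EuclideanSpace.single j 1)‖ ^ 2

theorem Integrable.memLp_norm_two {α E : Type*} [MeasurableSpace α] [NormedAddCommGroup E]
    {μ : Measure α} {f : α → E} (hf : Integrable (fun x => ‖f x‖ ^ 2) μ) :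
    MemLp (fun x => ‖f x‖) 2 μ := by
  have hm : AEStronglyMeasurable (fun x => ‖f x‖) μ := by
    have := Real.continuous_sqrt.comp_aestronglyMeasurable hf.aestronglyMeasurable
    simpa [Real.sqrt_sq (norm_nonneg _)] using this
  exact (memLp_two_iff_integrable_sq hm).2 hf

/-- Cauchy–Schwarz for the integral of an inner product. Only the norms of `f` and `g` need to be
measurable. -/
theorem integral_abs_inner_le_sqrt_mul_sqrt {α E : Type*} [MeasurableSpace α]
    [NormedAddCommGroup E] [InnerProductSpace ℝ E] {μ : Measure α} {f g : α → E}
    (hf : Integrable (fun x => ‖f x‖ ^ 2) μ) (hg : Integrable (fun x => ‖g x‖ ^ 2) μ) :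
    ∫ x, |⟪f x, g x⟫| ∂μ ≤ √(∫ x, ‖f x‖ ^ 2 ∂μ) * √(∫ x, ‖g x‖ ^ 2 ∂μ) := by
  have hf' := Integrable.memLp_norm_two hf
  have hg' := Integrable.memLp_norm_two hg
  calc ∫ x, |⟪f x, g x⟫| ∂μ ≤ ∫ x, ‖f x‖ * ‖g x‖ ∂μ :=
        integral_mono_of_nonneg (.of_forall fun _ => abs_nonneg _) (hf'.integrable_mul hg')
          (.of_forall fun x => abs_real_inner_le_norm (f x) (g x))
    _ ≤ √(∫ x, ‖f x‖ ^ 2 ∂μ) * √(∫ x, ‖g x‖ ^ 2 ∂μ) := by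
        have h := integral_mul_le_Lp_mul_Lq_of_nonneg (μ := μ) Real.HolderConjugate.two_two
          (.of_forall fun x => norm_nonneg (f x)) (.of_forall fun x => norm_nonneg (g x))
          (by simpa using hf') (by simpa using hg')
        simpa [Real.sqrt_eq_rpow] using h

theorem integrable_gradSq {d : ℕ} {v : EuclideanSpace ℝ (Fin d) → EuclideanSpace ℝ (Fin d)}
    (hv : ContDiff ℝ 1 v) (hc : HasCompactSupport v) : Integrable (gradSq v) := by
  have hcont : Continuous (fderiv ℝ v) := hv.continuous_fderiv one_ne_zero
  refine integrable_finsetSum _ fun j _ => Continuous.integrable_of_hasCompactSupport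
    (by fun_prop) ?_
  exact (hc.fderiv ℝ).comp_left
    (g := fun L : EuclideanSpace ℝ (Fin d) →L[ℝ] EuclideanSpace ℝ (Fin d) =>
      ‖L (EuclideanSpace.single j 1)‖ ^ 2) (by simp)

theorem gradSq_nonneg {d : ℕ} (v : EuclideanSpace ℝ (Fin d) → EuclideanSpace ℝ (Fin d))
    (x : EuclideanSpace ℝ (Fin d)) : 0 ≤ gradSq v x :=
  Finset.sum_nonneg fun _ _ => sq_nonneg _

/-- Absorbing the right-hand side of a penalized energy inequality by Young's inequality. -/
theorem sqrt_le_of_penalized_energy {X Y K ν m θ : ℝ} (hX : 0 ≤ X) (hY : 0 ≤ Y) (hK : 0 ≤ K)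
    (hν : 0 < ν) (hm : 1 ≤ m) (hθ : θ ≤ ν / 2)
    (h : ν * X + ν * m * Y ≤ K * √Y + θ * (X + Y)) :
    √X ≤ K * ν⁻¹ * m ^ (-(1/2) : ℝ) := by
  have hm0 : 0 < m := by linarith
  have hrpow : (m ^ (-(1/2) : ℝ)) ^ 2 = m⁻¹ := by
    rw [← Real.rpow_natCast, ← Real.rpow_mul hm0.le, ← Real.rpow_neg_one]
    norm_num
  refine Real.sqrt_le_iff.2 ⟨by positivity, ?_⟩
  rw [mul_pow, mul_pow, hrpow]
  have hθ' : θ * (X + Y) ≤ ν / 2 * (X + Y) := by gcongr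
  have hmY : ν * Y ≤ ν * m * Y := by
    nlinarith [mul_nonneg (mul_nonneg hν.le (sub_nonneg.2 hm)) hY]
  have henergy : ν * X + ν * m * Y ≤ 2 * (K * √Y) := by linarith
  have hscaled : ν * m * (ν * X + ν * m * Y) ≤ ν * m * (2 * (K * √Y)) := by gcongr
  have hyoung : ν ^ 2 * m * X ≤ K ^ 2 := by
    have hsq : (ν * m * √Y) ^ 2 = (ν * m) ^ 2 * Y := by rw [mul_pow, Real.sq_sqrt hY]
    linarith [sq_nonneg (ν * m * √Y - K)]
  calc X = ν ^ 2 * m * X * (ν⁻¹ ^ 2 * m⁻¹) := by field_simp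
    _ ≤ K ^ 2 * (ν⁻¹ ^ 2 * m⁻¹) := by gcongr
    _ = K ^ 2 * ν⁻¹ ^ 2 * m⁻¹ := by ring

/-- Improved error estimate (visc:4) of Theorem 2: under the error inequality,
the Poincaré inequality on the obstacle and a trace inequality on the
interface, the `H¹`-seminorm of `v = u_m − u` on the fluid region is
`O(ν^{-1} m^{-1/2})`, with a constant depending only on `C_P`, `C_T`,
`∫_{Ω_S} |f|²` and `∫_Σ |g|²`. -/
theorem viscosity_penalization_improved_fluid_estimate
    (d : ℕ) (hd : 1 ≤ d) :
    ∃ C : ℝ → ℝ → ℝ → ℝ → ℝ,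
      ∀ (Ω ΩS Sig : Set (EuclideanSpace ℝ (Fin d))),
        IsOpen Ω → Bornology.IsBounded Ω → MeasurableSet ΩS → ΩS ⊆ Ω →
        MeasurableSet Sig → μH[(d : ℝ) - 1] Sig < ⊤ →
      ∀ (f g v : EuclideanSpace ℝ (Fin d) → EuclideanSpace ℝ (Fin d)),
        IntegrableOn (fun x => ‖f x‖ ^ 2) ΩS →
        Integrable (fun x => ‖g x‖ ^ 2) (μH[(d : ℝ) - 1].restrict Sig) →
        ContDiff ℝ 1 v → HasCompactSupport v →
      ∀ (ν m θ C_P C_T : ℝ),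
        0 < ν → 1 ≤ m → 0 ≤ θ → θ ≤ ν / 2 → 0 ≤ C_P → 0 ≤ C_T →
        (ν * ∫ x in Ω \ ΩS, gradSq v x) + (ν * m * ∫ x in ΩS, gradSq v x)
          ≤ (∫ x in ΩS, ⟪f x, v x⟫)
            + (∫ x in Sig, |⟪g x, v x⟫| ∂μH[(d : ℝ) - 1])
            + θ * ∫ x in Ω, gradSq v x →
        (∫ x in ΩS, ‖v x‖ ^ 2) ≤ C_P * ∫ x in ΩS, gradSq v x →
        (∫ x in Sig, ‖v x‖ ^ 2 ∂μH[(d : ℝ) - 1]) ≤ C_T * ∫ x in ΩS, gradSq v x →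
        Real.sqrt (∫ x in Ω \ ΩS, gradSq v x)
          ≤ C C_P C_T (∫ x in ΩS, ‖f x‖ ^ 2)
              (∫ x in Sig, ‖g x‖ ^ 2 ∂μH[(d : ℝ) - 1])
            * ν⁻¹ * m ^ (-(1/2) : ℝ) := by
  refine ⟨fun C_P C_T F G => √F * √C_P + √G * √C_T, ?_⟩
  intro Ω ΩS Sig hΩ _ hΩS hsub _ hfin f g v hf hg hv hc ν m θ C_P C_T hν hm _ hθ hCP hCT
    henergy hpoincare htrace
  have : IsFiniteMeasure (μH[(d : ℝ) - 1].restrict Sig) := ⟨by simpa using hfin⟩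
  have hcont : Continuous fun x => ‖v x‖ ^ 2 := by have := hv.continuous; fun_prop
  have hsupp : HasCompactSupport fun x => ‖v x‖ ^ 2 :=
    hc.comp_left (g := fun y => ‖y‖ ^ 2) (by simp)
  have hgrad := integrable_gradSq hv hc
  have hsplit : ∫ x in Ω, gradSq v x
      = (∫ x in Ω \ ΩS, gradSq v x) + ∫ x in ΩS, gradSq v x := by
    rw [setIntegral_sdiff hΩS hgrad.integrableOn hsub]
    ring
  have hvolume : ∫ x in ΩS, ⟪f x, v x⟫
      ≤ √(∫ x in ΩS, ‖f x‖ ^ 2) * √C_P * √(∫ x in ΩS, gradSq v x) :=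
    calc ∫ x in ΩS, ⟪f x, v x⟫ ≤ ∫ x in ΩS, |⟪f x, v x⟫| :=
          (le_abs_self _).trans abs_integral_le_integral_abs
      _ ≤ √(∫ x in ΩS, ‖f x‖ ^ 2) * √(∫ x in ΩS, ‖v x‖ ^ 2) :=
          integral_abs_inner_le_sqrt_mul_sqrt hf
            (hcont.integrable_of_hasCompactSupport hsupp).integrableOn
      _ ≤ √(∫ x in ΩS, ‖f x‖ ^ 2) * √(C_P * ∫ x in ΩS, gradSq v x) := by gcongr
      _ = _ := by rw [Real.sqrt_mul hCP, mul_assoc]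
  have hsurface : ∫ x in Sig, |⟪g x, v x⟫| ∂μH[(d : ℝ) - 1]
      ≤ √(∫ x in Sig, ‖g x‖ ^ 2 ∂μH[(d : ℝ) - 1]) * √C_T * √(∫ x in ΩS, gradSq v x) :=
    calc ∫ x in Sig, |⟪g x, v x⟫| ∂μH[(d : ℝ) - 1]
      _ ≤ √(∫ x in Sig, ‖g x‖ ^ 2 ∂μH[(d : ℝ) - 1])
            * √(∫ x in Sig, ‖v x‖ ^ 2 ∂μH[(d : ℝ) - 1]) :=
          integral_abs_inner_le_sqrt_mul_sqrt hg (hcont.integrable_of_hasCompactSupport hsupp)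
      _ ≤ √(∫ x in Sig, ‖g x‖ ^ 2 ∂μH[(d : ℝ) - 1])
            * √(C_T * ∫ x in ΩS, gradSq v x) := by gcongr
      _ = _ := by rw [Real.sqrt_mul hCT, mul_assoc]
  rw [hsplit] at henergy
  refine sqrt_le_of_penalized_energy (Y := ∫ x in ΩS, gradSq v x)
    (integral_nonneg fun x => gradSq_nonneg v x)
    (integral_nonneg fun x => gradSq_nonneg v x) (by positivity) hν hm hθ ?_
  linarith
end
end

section
/- Let ν > 0, n ≥ 1 and 0 ≤ θ ≤ ν/2. Let v : ℝ^d → ℝ^d be continuously differentiable with compact support and suppose: (i) the error inequality ν ∫_Ω |∇v|² dx + n ∫_{Ω_S} |v|² dx ≤ ∫_{Ω_S} f·v dx + ∫_Σ |g·v| d𝓗^{d−1} + θ ∫_Ω |∇v|² dx holds; (ii) the interpolation trace inequality ∫_Σ |v|² d𝓗^{d−1} ≤ C_T · (∫_Ω |∇v|² dx)^{1/2} · (∫_{Ω_S} |v|² dx)^{1/2} holds for some C_T ≥ 0. Then there is a constant C depending only on ν, C_T, ∫_{Ω_S} |f|² dx and ∫_Σ |g|² d𝓗^{d−1} (but not on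 n) such that (∫_{Ω_S} |v|² dx)^{1/2} ≤ C · n^{-3/4}. (This is the improved volume-penalization estimate (vol:3) of Theorem 1, with v playing the role of u_n on the obstacle and θ the absorbed convective contribution under the smallness assumption on f.) -/
open MeasureTheory
open scoped RealInnerProductSpace

noncomputable section

lemma le_two_mul_add_sqrt_of_sq_le {A D t : ℝ} (hA : 0 ≤ A) (hD : 0 ≤ D)
    (h : t ^ 2 ≤ 2 * A * t + D) : t ≤ 2 * A + √D := by
  by_contra! hlt
  have h1 := Real.sqrt_nonneg D
  have h2 := Real.sq_sqrt hD
  nlinarith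

/-- Young's inequality in the form that absorbs `√(K H t)` into a quadratic form. -/
lemma le_of_sq_le_mul_mul {K H t x e : ℝ} (he : 0 < e) (hK : 0 ≤ K) (hH : 0 ≤ H) (ht : 0 ≤ t)
    (hx : x ^ 2 ≤ K * H * t) : x ≤ K / (4 * e) + e ^ 2 / 2 * H ^ 2 + t ^ 2 / 2 := by
  have h1 : x ≤ K / (4 * e) + e * H * t := by
    apply le_of_sq_le_sq _ (by positivity)
    have : K * H * t = 4 * (K / (4 * e)) * (e * H * t) := by field_simp
    nlinarith [sq_nonneg (K / (4 * e) - e * H * t)]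
  nlinarith [sq_nonneg (e * H - t)]

/-- Cauchy–Schwarz for `∫ ‖f‖ ‖v‖`, where only `‖f‖ ^ 2` is known to be measurable. -/
lemma integrable_and_integral_norm_mul_norm_le {α E : Type*} [MeasurableSpace α]
    [NormedAddCommGroup E] {μ : Measure α} {f v : α → E}
    (hf : Integrable (fun x => ‖f x‖ ^ 2) μ) (hv : Integrable (fun x => ‖v x‖ ^ 2) μ) :
    Integrable (fun x => ‖f x‖ * ‖v x‖) μ ∧
      ∫ x, ‖f x‖ * ‖v x‖ ∂μ ≤ √(∫ x, ‖f x‖ ^ 2 ∂μ) * √(∫ x, ‖v x‖ ^ 2 ∂μ) := by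
  have memLp_norm : ∀ {u : α → E}, Integrable (fun x => ‖u x‖ ^ 2) μ →
      MemLp (fun x => ‖u x‖) 2 μ := by
    intro u hu
    refine (memLp_two_iff_integrable_sq ?_).2 hu
    have h := Real.continuous_sqrt.comp_aestronglyMeasurable hu.aestronglyMeasurable
    simpa [Function.comp_def, Real.sqrt_sq (norm_nonneg _)] using h
  refine ⟨(memLp_norm hf).integrable_mul (memLp_norm hv), ?_⟩
  have h := integral_mul_le_Lp_mul_Lq_of_nonneg (μ := μ) Real.HolderConjugate.two_two
    (f := fun x => ‖f x‖) (g := fun x => ‖v x‖)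
    (.of_forall fun _ => norm_nonneg _) (.of_forall fun _ => norm_nonneg _)
    (by simpa using memLp_norm hf) (by simpa using memLp_norm hv)
  simpa [Real.sqrt_eq_rpow] using h

lemma sqrt_le_of_penalized_energy_le {ν n θ c P Q F G W : ℝ} (hν : 0 < ν) (hn : 1 ≤ n)
    (hθ : θ ≤ ν / 2) (hc : 0 ≤ c) (hP : 0 ≤ P) (hQ : 0 ≤ Q) (hG : 0 ≤ G) (hW : 0 ≤ W)
    (henergy : ν * P + n * Q ≤ √F * √Q + √G * √W + θ * P)
    (htrace : W ≤ c * √P * √Q) :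
    √Q ≤ (2 * √F + √(G * c / (2 * √ν))) * n ^ (-(3/4) : ℝ) := by
  have hn0 : 0 < n := by linarith
  obtain ⟨m, hm⟩ : ∃ m, m = n ^ (1/4 : ℝ) := ⟨_, rfl⟩
  have hm1 : 1 ≤ m := hm ▸ Real.one_le_rpow hn (by norm_num)
  have hm0 : 0 < m := by linarith
  have hm4 : n = m ^ 4 := by
    rw [hm, ← Real.rpow_natCast, ← Real.rpow_mul hn0.le]; norm_num
  have hm3 : n ^ (-(3/4) : ℝ) = (m ^ 3)⁻¹ := by
    rw [hm, ← Real.rpow_natCast, ← Real.rpow_mul hn0.le, ← Real.rpow_neg hn0.le]; norm_num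
  rw [hm3, ← div_eq_mul_inv, le_div_iff₀ (by positivity)]
  have hP2 := Real.sq_sqrt hP
  have hQ2 := Real.sq_sqrt hQ
  have hp := Real.sqrt_nonneg P
  have hq := Real.sqrt_nonneg Q
  have hA := Real.sqrt_nonneg F
  generalize √P = p at *
  generalize √Q = q at *
  generalize √F = A at *
  have hx2 : (m ^ 2 * (√G * √W)) ^ 2 ≤ (G * c) * (m * p) * (m ^ 3 * q) := by
    rw [mul_pow, mul_pow, Real.sq_sqrt hG, Real.sq_sqrt hW]
    calc (m ^ 2) ^ 2 * (G * W) ≤ (m ^ 2) ^ 2 * (G * (c * p * q)) := by gcongr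
      _ = _ := by ring
  have hyoung := le_of_sq_le_mul_mul (Real.sqrt_pos.2 hν) (by positivity) (by positivity)
    (by positivity) hx2
  rw [Real.sq_sqrt hν.le] at hyoung
  have hscaled : ν / 2 * (m * p) ^ 2 + (m ^ 3 * q) ^ 2 ≤
      A * (m ^ 3 * q) + m ^ 2 * (√G * √W) := by
    have h1 : ν / 2 * p ^ 2 + m ^ 4 * q ^ 2 ≤ A * q + √G * √W := by
      rw [hP2, hQ2, ← hm4]
      nlinarith [mul_le_mul_of_nonneg_right hθ hP]
    have h2 := mul_le_mul_of_nonneg_left h1 (sq_nonneg m)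
    have h3 : m ^ 2 * (A * q) ≤ m ^ 3 * (A * q) := by
      gcongr
      norm_num
    nlinarith
  rw [mul_comm q]
  refine le_two_mul_add_sqrt_of_sq_le hA (by positivity) ?_
  have : G * c / (2 * √ν) = 2 * (G * c / (4 * √ν)) := by
    have := Real.sqrt_pos.2 hν
    field_simp
    norm_num
  rw [this]
  linarith

/-- Improved volume-penalization estimate (vol:3) of Theorem 1: under the
error inequality and the interpolation trace inequality, the `L²`-norm of
`v = u_n` on the obstacle region is `O(n^{-3/4})`, with a constant depending
only on `ν`, `C_T`, `∫_{Ω_S} |f|²` and `∫_Σ |g|²` (but not on `n`). -/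
theorem volume_penalization_improved_obstacle_estimate
    (d : ℕ) (hd : 1 ≤ d) :
    ∃ C : ℝ → ℝ → ℝ → ℝ → ℝ,
      ∀ (Ω ΩS Sig : Set (EuclideanSpace ℝ (Fin d))),
        IsOpen Ω → Bornology.IsBounded Ω → MeasurableSet ΩS → ΩS ⊆ Ω →
        MeasurableSet Sig → μH[(d : ℝ) - 1] Sig < ⊤ →
      ∀ (f g v : EuclideanSpace ℝ (Fin d) → EuclideanSpace ℝ (Fin d)),
        IntegrableOn (fun x => ‖f x‖ ^ 2) ΩS →
        Integrable (fun x => ‖g x‖ ^ 2) (μH[(d : ℝ) - 1].restrict Sig) →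
        ContDiff ℝ 1 v → HasCompactSupport v →
      ∀ (ν n θ C_T : ℝ),
        0 < ν → 1 ≤ n → 0 ≤ θ → θ ≤ ν / 2 → 0 ≤ C_T →
        (ν * ∫ x in Ω, gradSq v x) + (n * ∫ x in ΩS, ‖v x‖ ^ 2)
          ≤ (∫ x in ΩS, ⟪f x, v x⟫)
            + (∫ x in Sig, |⟪g x, v x⟫| ∂μH[(d : ℝ) - 1])
            + θ * ∫ x in Ω, gradSq v x →
        (∫ x in Sig, ‖v x‖ ^ 2 ∂μH[(d : ℝ) - 1])
          ≤ C_T * Real.sqrt (∫ x in Ω, gradSq v x)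
              * Real.sqrt (∫ x in ΩS, ‖v x‖ ^ 2) →
        Real.sqrt (∫ x in ΩS, ‖v x‖ ^ 2)
          ≤ C ν C_T (∫ x in ΩS, ‖f x‖ ^ 2)
              (∫ x in Sig, ‖g x‖ ^ 2 ∂μH[(d : ℝ) - 1])
            * n ^ (-(3/4) : ℝ) := by
  refine ⟨fun ν c F G => 2 * √F + √(G * c / (2 * √ν)), ?_⟩
  intro Ω ΩS Sig _ hΩ _ hsub _ hSig f g v hf hg hv hvc ν n θ c hν hn _ hθ hc henergy htrace
  have integrable_sq : ∀ (μ : Measure (EuclideanSpace ℝ (Fin d))) [IsFiniteMeasure μ],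
      Integrable (fun x => ‖v x‖ ^ 2) μ := by
    intro μ _
    obtain ⟨M, hM⟩ := hvc.exists_bound_of_continuous hv.continuous
    refine Integrable.of_bound (hv.continuous.norm.pow 2).aestronglyMeasurable (M ^ 2)
      (.of_forall fun x => ?_)
    rw [norm_pow, norm_norm]
    exact pow_le_pow_left₀ (norm_nonneg _) (hM x) 2
  have : IsFiniteMeasure (volume.restrict ΩS) :=
    ⟨by simpa using (hΩ.subset hsub).measure_lt_top⟩
  have : IsFiniteMeasure (μH[(d : ℝ) - 1].restrict Sig) := ⟨by simpa using hSig⟩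
  obtain ⟨hfv, hfv_le⟩ := integrable_and_integral_norm_mul_norm_le hf
    (integrable_sq (volume.restrict ΩS))
  obtain ⟨hgv, hgv_le⟩ := integrable_and_integral_norm_mul_norm_le hg
    (integrable_sq (μH[(d : ℝ) - 1].restrict Sig))
  have hbulk : ∫ x in ΩS, ⟪f x, v x⟫ ≤ ∫ x in ΩS, ‖f x‖ * ‖v x‖ :=
    (Real.le_norm_self _).trans <| norm_integral_le_of_norm_le hfv
      (.of_forall fun x => abs_real_inner_le_norm _ _)
  have hsurf : ∫ x in Sig, |⟪g x, v x⟫| ∂μH[(d : ℝ) - 1] ≤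
      ∫ x in Sig, ‖g x‖ * ‖v x‖ ∂μH[(d : ℝ) - 1] :=
    integral_mono_of_nonneg (.of_forall fun _ => abs_nonneg _) hgv
      (.of_forall fun x => abs_real_inner_le_norm _ _)
  refine sqrt_le_of_penalized_energy_le (P := ∫ x in Ω, gradSq v x) hν hn hθ hc
    (integral_nonneg fun x => Finset.sum_nonneg fun _ _ => sq_nonneg _)
    (integral_nonneg fun _ => sq_nonneg _) (integral_nonneg fun _ => sq_nonneg _)
    (integral_nonneg fun _ => sq_nonneg _) ?_ htrace
  linarith
end
end
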